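/- Fix k ≥ 3, d ≥ k - 1, c ∈ (0,1), and ε > 0. Let B(n) be the set of graphs in G_{d,c,k}(n) having more than ε·n bad vertices, where a vertex is bad if it is contained in a k-clique but not contained in any clique on d+1 vertices. Then |B(n)| / |G_{d,c,k}(n)| → 0 as n → ∞ along integers n with n·d even. -/

import Mathlib

open Filter

/-- The number of `k`-cliques (sets of `k` mutually adjacent vertices) in a graph. -/
noncomputable def cliqueCount {V : Type*} (G : SimpleGraph V) (k : ℕ) : ℕ :=
  Nat.card {t : Finset V // G.IsNClique k t}

/-- A graph is `d`-regular: every vertex has degree exactly `d`. -/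
def IsDRegular {V : Type*} (G : SimpleGraph V) (d : ℕ) : Prop :=
  ∀ v : V, (G.neighborSet v).ncard = d

/-- `G_{d,c,k}(n)`: the set of simple `d`-regular graphs on the labeled vertex set `Fin n`
with at least `c * choose d (k-1) * n / k` `k`-cliques. -/
noncomputable def Gdck (n d : ℕ) (c : ℝ) (k : ℕ) : Set (SimpleGraph (Fin n)) :=
  {G | IsDRegular G d ∧ c * ((d.choose (k - 1) : ℝ) * n / k) ≤ (cliqueCount G k : ℝ)}

/-- A vertex is bad (for `k`-cliques) if it lies in a `k`-clique but in no clique on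
`d+1` vertices. -/
def BadVertexK {V : Type*} (G : SimpleGraph V) (d k : ℕ) (v : V) : Prop :=
  (∃ t : Finset V, G.IsNClique k t ∧ v ∈ t) ∧
    ¬∃ s : Finset V, G.IsNClique (d + 1) s ∧ v ∈ s

/-- The number of bad vertices (for `k`-cliques) of a graph. -/
noncomputable def badVertexCountK {V : Type*} (G : SimpleGraph V) (d k : ℕ) : ℕ :=
  Nat.card {v : V // BadVertexK G d k v}

section Permutations

variable {V : Type*} [Fintype V] [LinearOrder V]

/-- Among all permutations, the proportion placing a given element of `S` first in `S` is
`1 / #S`. -/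
theorem card_perm_first_mul_card {S : Finset V} {v : V} (hv : v ∈ S) :
    (Finset.univ.filter fun σ : Equiv.Perm V => ∀ u ∈ S, σ v ≤ σ u).card * S.card =
      (Fintype.card V).factorial := by
  have hsymm : ∀ w ∈ S,
      (Finset.univ.filter fun σ : Equiv.Perm V => ∀ u ∈ S, σ w ≤ σ u).card =
        (Finset.univ.filter fun σ : Equiv.Perm V => ∀ u ∈ S, σ v ≤ σ u).card := by
    intro w hw
    have hswap : ∀ u ∈ S, Equiv.swap v w u ∈ S := by
      intro u hu
      rw [Equiv.swap_apply_def]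
      split_ifs <;> assumption
    refine Finset.card_bij' (fun σ _ => σ * Equiv.swap v w) (fun σ _ => σ * Equiv.swap v w)
      ?_ ?_ ?_ ?_
    · intro σ hσ
      simp only [Finset.mem_filter, Finset.mem_univ, true_and, Equiv.Perm.mul_apply,
        Equiv.swap_apply_left] at hσ ⊢
      exact fun u hu => hσ _ (hswap u hu)
    · intro σ hσ
      simp only [Finset.mem_filter, Finset.mem_univ, true_and, Equiv.Perm.mul_apply,
        Equiv.swap_apply_right] at hσ ⊢
      exact fun u hu => hσ _ (hswap u hu)
    · intro σ _
      simp [mul_assoc]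
    · intro σ _
      simp [mul_assoc]
  have hdisj : (S : Set V).PairwiseDisjoint
      fun w => Finset.univ.filter fun σ : Equiv.Perm V => ∀ u ∈ S, σ w ≤ σ u := by
    intro a ha b hb hab
    refine Finset.disjoint_left.mpr fun σ h1 h2 => hab (σ.injective ?_)
    simp only [Finset.mem_filter, Finset.mem_univ, true_and] at h1 h2
    exact le_antisymm (h1 b hb) (h2 a ha)
  have hunion : (S.biUnion
      fun w => Finset.univ.filter fun σ : Equiv.Perm V => ∀ u ∈ S, σ w ≤ σ u) =
        Finset.univ := by
    refine Finset.eq_univ_iff_forall.mpr fun σ => ?_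
    obtain ⟨w, hw, hmin⟩ := S.exists_min_image σ ⟨v, hv⟩
    simp only [Finset.mem_biUnion, Finset.mem_filter, Finset.mem_univ, true_and]
    exact ⟨w, hw, hmin⟩
  have hcard := Finset.card_biUnion hdisj
  rw [hunion, Finset.sum_congr rfl hsymm, Finset.sum_const, smul_eq_mul, Finset.card_univ,
    Fintype.card_perm] at hcard
  rw [hcard, mul_comm]

/-- At least a proportion `#C / (#C + 2)` of all permutations place some element of `C` before
both `x` and `y`. -/
theorem card_mul_factorial_le_card_perm_before {C : Finset V} {x y : V} (hxy : x ≠ y)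
    (hx : x ∉ C) (hy : y ∉ C) :
    C.card * (Fintype.card V).factorial ≤
      (Finset.univ.filter fun σ : Equiv.Perm V => ∃ v ∈ C, σ v < σ x ∧ σ v < σ y).card *
        (C.card + 2) := by
  set S := insert x (insert y C) with hS
  have hScard : S.card = C.card + 2 := by
    rw [hS, Finset.card_insert_of_notMem, Finset.card_insert_of_notMem hy]
    simp [hxy, hx]
  have hCS : ∀ v ∈ C, v ∈ S := fun v hv => by simp [hS, hv]
  have hdisj : (C : Set V).PairwiseDisjoint
      fun w => Finset.univ.filter fun σ : Equiv.Perm V => ∀ u ∈ S, σ w ≤ σ u := by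
    intro a ha b hb hab
    refine Finset.disjoint_left.mpr fun σ h1 h2 => hab (σ.injective ?_)
    simp only [Finset.mem_filter, Finset.mem_univ, true_and] at h1 h2
    exact le_antisymm (h1 b (hCS b hb)) (h2 a (hCS a ha))
  have hsub : (C.biUnion
      fun w => Finset.univ.filter fun σ : Equiv.Perm V => ∀ u ∈ S, σ w ≤ σ u) ⊆
        Finset.univ.filter fun σ : Equiv.Perm V => ∃ v ∈ C, σ v < σ x ∧ σ v < σ y := by
    intro σ hσ
    simp only [Finset.mem_biUnion, Finset.mem_filter, Finset.mem_univ, true_and] at hσ ⊢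
    obtain ⟨v, hv, hmin⟩ := hσ
    refine ⟨v, hv, lt_of_le_of_ne (hmin x (by simp [hS])) ?_,
      lt_of_le_of_ne (hmin y (by simp [hS])) ?_⟩
    · exact fun h => hx (σ.injective h ▸ hv)
    · exact fun h => hy (σ.injective h ▸ hv)
  calc C.card * (Fintype.card V).factorial
      = (C.biUnion fun w =>
          Finset.univ.filter fun σ : Equiv.Perm V => ∀ u ∈ S, σ w ≤ σ u).card *
            (C.card + 2) := by
        rw [Finset.card_biUnion hdisj, Finset.sum_mul, ← hScard,
          Finset.sum_congr rfl fun w hw => card_perm_first_mul_card (hCS w hw),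
          Finset.sum_const, smul_eq_mul]
    _ ≤ _ := Nat.mul_le_mul_right _ (Finset.card_le_card hsub)

end Permutations

section Generation

variable {V : Type*}

/-- `A` generates `G` if `G` arises from `A` by successively closing triangles: every proper
intermediate graph has two edges of a triangle of `G` whose third edge is missing. -/
def TriangleGenerates (A G : SimpleGraph V) : Prop :=
  A ≤ G ∧ ∀ B, A ≤ B → B ≤ G → B ≠ G →
    ∃ x v y, B.Adj v x ∧ B.Adj v y ∧ G.Adj x y ∧ ¬B.Adj x y

/-- The edges that are not opposite to the earliest vertex of a triangle. -/
def unsavedGraph [LinearOrder V] (G : SimpleGraph V) (σ : Equiv.Perm V) : SimpleGraph V where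
  Adj x y := G.Adj x y ∧ ¬∃ v, (G.Adj v x ∧ G.Adj v y) ∧ σ v < σ x ∧ σ v < σ y
  symm := ⟨fun _ _ h => ⟨h.1.symm, fun ⟨v, hv, hx, hy⟩ => h.2 ⟨v, hv.symm, hy, hx⟩⟩⟩
  loopless := ⟨fun x h => G.loopless.irrefl x h.1⟩

theorem unsavedGraph_generates [Finite V] [LinearOrder V] (G : SimpleGraph V)
    (σ : Equiv.Perm V) : TriangleGenerates (unsavedGraph G σ) G := by
  refine ⟨fun _ _ h => h.1, fun B hAB hBG hne => ?_⟩
  have hex : ∃ z, ∃ x y, G.Adj x y ∧ ¬B.Adj x y ∧ min (σ x) (σ y) = z := by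
    by_contra! hcon
    refine hne (le_antisymm hBG fun x y hxy => ?_)
    by_contra hB
    exact hcon _ x y hxy hB rfl
  obtain ⟨z, ⟨x, y, hxy, hB, hz⟩, hmin⟩ :=
    WellFounded.has_min (wellFounded_lt (α := V))
      {z | ∃ x y, G.Adj x y ∧ ¬B.Adj x y ∧ min (σ x) (σ y) = z} hex
  have hsaved : ∃ v, (G.Adj v x ∧ G.Adj v y) ∧ σ v < σ x ∧ σ v < σ y := by
    by_contra hcon
    exact hB (hAB ⟨hxy, hcon⟩)
  obtain ⟨v, ⟨hvx, hvy⟩, h1, h2⟩ := hsaved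
  have hvz : σ v < z := hz ▸ lt_min h1 h2
  refine ⟨x, v, y, ?_, ?_, hxy, hB⟩
  · by_contra hcon
    exact hmin _ ⟨v, x, hvx, hcon, rfl⟩ ((min_le_left _ _).trans_lt hvz)
  · by_contra hcon
    exact hmin _ ⟨v, y, hvy, hcon, rfl⟩ ((min_le_left _ _).trans_lt hvz)

variable [Fintype V]

open scoped Classical in
/-- The paths with two edges (possibly degenerate), as triples with the centre in the middle. -/
noncomputable def wedges (G : SimpleGraph V) : Finset (V × V × V) :=
  Finset.univ.filter fun w => G.Adj w.2.1 w.1 ∧ G.Adj w.2.1 w.2.2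

theorem wedges_mono {A G : SimpleGraph V} (h : A ≤ G) : wedges A ⊆ wedges G := by
  intro w hw
  simp only [wedges, Finset.mem_filter, Finset.mem_univ, true_and] at hw ⊢
  exact ⟨h hw.1, h hw.2⟩

open scoped Classical in
theorem card_wedges {G : SimpleGraph V} {d : ℕ}
    (hG : ∀ v, (Finset.univ.filter (G.Adj v)).card = d) :
    (wedges G).card = Fintype.card V * d ^ 2 := by
  have hfib : ∀ v : V, ((wedges G).filter fun w => w.2.1 = v).card = d ^ 2 := by
    intro v
    rw [sq, ← hG v, ← Finset.card_product]
    refine Finset.card_bij' (fun w _ => (w.1, w.2.2)) (fun p _ => (p.1, v, p.2)) ?_ ?_ ?_ ?_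
    · rintro ⟨x, u, y⟩ hw
      simp only [wedges, Finset.mem_filter, Finset.mem_univ, true_and,
        Finset.mem_product] at hw ⊢
      exact hw.2 ▸ hw.1
    · rintro ⟨x, y⟩ hw
      simpa [wedges] using hw
    · rintro ⟨x, u, y⟩ hw
      simp only [Finset.mem_filter] at hw
      simp [hw.2]
    · rintro ⟨x, y⟩ _
      rfl
  rw [Finset.card_eq_sum_card_fiberwise (f := fun w : V × V × V => w.2.1) (t := Finset.univ)
    (fun _ _ => by simp), Finset.sum_congr rfl fun v _ => hfib v]
  simp

open scoped Classical in
/-- The number of graphs with at most `K` wedges generated by `A`, when the wedges in `W` are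
already known to be treated correctly in `A`. -/
theorem card_generated_le_aux (K N : ℕ) : ∀ (A : SimpleGraph V) (W : Finset (V × V × V)),
    W ⊆ wedges A → K ≤ W.card + N →
    (Finset.univ.filter fun G : SimpleGraph V => TriangleGenerates A G ∧ (wedges G).card ≤ K ∧
      ∀ w ∈ W, G.Adj w.1 w.2.2 → A.Adj w.1 w.2.2).card ≤ 2 ^ N := by
  induction N with
  | zero =>
    intro A W hW hK
    refine (Finset.card_le_card (t := {A}) fun G hG => ?_).trans (by simp)
    simp only [Finset.mem_filter, Finset.mem_univ, true_and] at hG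
    obtain ⟨hgen, hcard, hclosed⟩ := hG
    have hWG : W = wedges G :=
      Finset.eq_of_subset_of_card_le (hW.trans (wedges_mono hgen.1)) (by omega)
    rw [Finset.mem_singleton]
    by_contra hne
    obtain ⟨x, v, y, h1, h2, h3, h4⟩ := hgen.2 A le_rfl hgen.1 (Ne.symm hne)
    refine h4 (hclosed (x, v, y) ?_ h3)
    rw [hWG]
    simp [wedges, hgen.1 h1, hgen.1 h2]
  | succ N ih =>
    intro A W hW hK
    by_cases hex : ∃ w ∈ wedges A, w ∉ W
    · obtain ⟨⟨x, v, y⟩, hwA, hwW⟩ := hex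
      have hle : A ≤ A ⊔ SimpleGraph.edge x y := le_sup_left
      have hW' : insert (x, v, y) W ⊆ wedges A := Finset.insert_subset hwA hW
      have hK' : K ≤ (insert (x, v, y) W).card + N := by
        rw [Finset.card_insert_of_notMem hwW]
        omega
      have h1 := ih A (insert (x, v, y) W) hW' hK'
      have h2 := ih (A ⊔ SimpleGraph.edge x y) (insert (x, v, y) W)
        (hW'.trans (wedges_mono hle)) hK'
      refine (Finset.card_le_card fun G hG => ?_).trans
        ((Finset.card_union_le _ _).trans ((add_le_add h1 h2).trans (by rw [pow_succ]; omega)))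
      simp only [Finset.mem_union, Finset.mem_filter, Finset.mem_univ, true_and,
        Finset.mem_insert, forall_eq_or_imp] at hG ⊢
      obtain ⟨hgen, hcard, hclosed⟩ := hG
      by_cases hxy : G.Adj x y
      · right
        refine ⟨⟨?_, fun B hB => hgen.2 B (hle.trans hB)⟩, hcard, ?_, ?_⟩
        · refine sup_le hgen.1 fun a b hab => ?_
          rw [SimpleGraph.edge_adj] at hab
          rcases hab with ⟨⟨rfl, rfl⟩ | ⟨rfl, rfl⟩, _⟩
          · exact hxy
          · exact hxy.symm
        · intro _
          refine Or.inr ?_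
          rw [SimpleGraph.edge_adj]
          exact ⟨Or.inl ⟨rfl, rfl⟩, hxy.ne⟩
        · exact fun w hw h => hle (hclosed w hw h)
      · left
        exact ⟨hgen, hcard, fun h => absurd h hxy, hclosed⟩
    · push Not at hex
      refine (Finset.card_le_card (t := {A}) fun G hG => ?_).trans
        (by simpa using Nat.one_le_two_pow)
      simp only [Finset.mem_filter, Finset.mem_univ, true_and] at hG
      obtain ⟨hgen, hcard, hclosed⟩ := hG
      rw [Finset.mem_singleton]
      by_contra hne
      obtain ⟨x, v, y, h1, h2, h3, h4⟩ := hgen.2 A le_rfl hgen.1 (Ne.symm hne)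
      exact h4 (hclosed (x, v, y) (hex _ (by simp [wedges, h1, h2])) h3)

open scoped Classical in
theorem card_generated_le (K : ℕ) (A : SimpleGraph V) :
    (Finset.univ.filter fun G : SimpleGraph V =>
      TriangleGenerates A G ∧ (wedges G).card ≤ K).card ≤ 2 ^ K := by
  simpa using card_generated_le_aux K K A ∅ (by simp) (by simp)

end Generation

section Counting

open scoped Classical

variable {V : Type*} [Fintype V]

/-- The ordered pairs of adjacent vertices. -/
noncomputable def adjPairs (G : SimpleGraph V) : Finset (V × V) :=
  Finset.univ.filter fun p => G.Adj p.1 p.2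

/-- The common neighbours of two vertices. -/
noncomputable def commonNbrs (G : SimpleGraph V) (x y : V) : Finset V :=
  Finset.univ.filter fun v => G.Adj v x ∧ G.Adj v y

theorem card_adjPairs_eq_sum (G : SimpleGraph V) :
    (adjPairs G).card = ∑ v, (Finset.univ.filter (G.Adj v)).card := by
  simp only [adjPairs, Finset.card_filter, Fintype.sum_prod_type]

theorem card_adjPairs (G : SimpleGraph V) : (adjPairs G).card = 2 * G.edgeFinset.card := by
  rw [← G.sum_degrees_eq_twice_card_edges, card_adjPairs_eq_sum]
  refine Finset.sum_congr rfl fun v _ => ?_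
  rw [← G.card_neighborFinset_eq_degree]
  congr 1
  ext w
  simp

/-- The number of graphs on `n` vertices with at most `f` edges is at most `e ^ n * n ^ f`. -/
theorem card_graphs_le (f : ℝ) (hV : 0 < Fintype.card V) :
    ((Finset.univ.filter fun F : SimpleGraph V => ((adjPairs F).card : ℝ) ≤ 2 * f).card : ℝ) ≤
      Real.exp (Fintype.card V) * (Fintype.card V : ℝ) ^ f := by
  set n := Fintype.card V with hn
  have hn1 : (1 : ℝ) ≤ n := by exact_mod_cast hV
  have hn0 : (0 : ℝ) < n := by linarith
  set 𝓕 := Finset.univ.filter fun F : SimpleGraph V => ((adjPairs F).card : ℝ) ≤ 2 * f with hF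
  have hweight : ∀ F ∈ 𝓕, (1 : ℝ) ≤ (n : ℝ) ^ f * (1 / (n : ℝ)) ^ F.edgeFinset.card := by
    intro F hFm
    simp only [hF, Finset.mem_filter, Finset.mem_univ, true_and, card_adjPairs] at hFm
    push_cast at hFm
    rw [one_div, inv_pow, ← Real.rpow_natCast, ← Real.rpow_neg hn0.le, ← Real.rpow_add hn0]
    exact Real.one_le_rpow hn1 (by linarith)
  have hinj : ∑ F ∈ 𝓕, (1 / (n : ℝ)) ^ F.edgeFinset.card ≤
      ∑ s ∈ (Finset.univ : Finset (Sym2 V)).powerset, (1 / (n : ℝ)) ^ s.card := by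
    rw [← Finset.sum_image (f := fun s : Finset (Sym2 V) => (1 / (n : ℝ)) ^ s.card)
      (g := fun F : SimpleGraph V => F.edgeFinset)
      (fun F _ F' _ h => SimpleGraph.edgeFinset_inj.mp h)]
    refine Finset.sum_le_sum_of_subset_of_nonneg (by simp) fun _ _ _ => by positivity
  have hpow : ∑ s ∈ (Finset.univ : Finset (Sym2 V)).powerset, (1 / (n : ℝ)) ^ s.card =
      (1 / (n : ℝ) + 1) ^ (Fintype.card (Sym2 V)) := by
    rw [← Finset.card_univ, ← Finset.sum_pow_mul_eq_add_pow]
    simp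
  have hsym : (Fintype.card (Sym2 V) : ℝ) ≤ n * n := by
    rw [Sym2.card, ← hn]
    have : (n + 1).choose 2 ≤ n * n := by
      rw [Nat.choose_two_right]
      refine Nat.div_le_of_le_mul ?_
      simp only [Nat.add_sub_cancel]
      nlinarith
    exact_mod_cast this
  calc (𝓕.card : ℝ) = ∑ F ∈ 𝓕, (1 : ℝ) := by simp
    _ ≤ ∑ F ∈ 𝓕, (n : ℝ) ^ f * (1 / (n : ℝ)) ^ F.edgeFinset.card := Finset.sum_le_sum hweight
    _ ≤ (n : ℝ) ^ f * (1 / (n : ℝ) + 1) ^ (Fintype.card (Sym2 V)) := by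
        rw [← Finset.mul_sum, ← hpow]
        gcongr
    _ ≤ (n : ℝ) ^ f * Real.exp (1 / n) ^ (Fintype.card (Sym2 V)) := by
        gcongr
        exact Real.add_one_le_exp _
    _ ≤ (n : ℝ) ^ f * Real.exp n := by
        rw [← Real.exp_nat_mul]
        gcongr
        rw [mul_one_div, div_le_iff₀ hn0]
        exact hsym
    _ = _ := mul_comm _ _

/-- Some vertex order saves at least `∑ m / (m + 2)` ordered pairs, where `m` is the number of
common neighbours of the pair. -/
theorem exists_card_unsaved_le [LinearOrder V] (G : SimpleGraph V) :
    ∃ σ : Equiv.Perm V, ((adjPairs (unsavedGraph G σ)).card : ℝ) +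
      ∑ p ∈ adjPairs G, ((commonNbrs G p.1 p.2).card : ℝ) / ((commonNbrs G p.1 p.2).card + 2) ≤
        (adjPairs G).card := by
  set g : ℝ := ∑ p ∈ adjPairs G,
    ((commonNbrs G p.1 p.2).card : ℝ) / ((commonNbrs G p.1 p.2).card + 2) with hg
  have hpair : ∀ p ∈ adjPairs G,
      ((commonNbrs G p.1 p.2).card : ℝ) / ((commonNbrs G p.1 p.2).card + 2) *
        (Fintype.card V).factorial ≤
      ∑ σ : Equiv.Perm V, if ∃ v ∈ commonNbrs G p.1 p.2, σ v < σ p.1 ∧ σ v < σ p.2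
        then (1 : ℝ) else 0 := by
    rintro ⟨x, y⟩ hp
    simp only [adjPairs, Finset.mem_filter, Finset.mem_univ, true_and] at hp
    have h := card_mul_factorial_le_card_perm_before (C := commonNbrs G x y) hp.ne
      (by simp [commonNbrs]) (by simp [commonNbrs])
    rw [← Finset.sum_filter, Finset.sum_const, nsmul_eq_mul, mul_one, div_mul_eq_mul_div,
      div_le_iff₀ (by positivity)]
    exact_mod_cast h
  have hsplit : ∀ σ : Equiv.Perm V,
      ((adjPairs G).card : ℝ) - (adjPairs (unsavedGraph G σ)).card =
        ∑ p ∈ adjPairs G, if ∃ v ∈ commonNbrs G p.1 p.2, σ v < σ p.1 ∧ σ v < σ p.2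
          then (1 : ℝ) else 0 := by
    intro σ
    rw [← Finset.sum_filter, Finset.sum_const, nsmul_eq_mul, mul_one, sub_eq_iff_eq_add,
      ← Finset.card_filter_add_card_filter_not (s := adjPairs G)
        (fun p => ∃ v ∈ commonNbrs G p.1 p.2, σ v < σ p.1 ∧ σ v < σ p.2)]
    push_cast
    congr 3
    ext p
    simp [adjPairs, unsavedGraph, commonNbrs]
  have havg : ∑ _σ : Equiv.Perm V, g ≤ ∑ σ : Equiv.Perm V,
      (((adjPairs G).card : ℝ) - (adjPairs (unsavedGraph G σ)).card) := by
    rw [Finset.sum_congr rfl fun σ _ => hsplit σ, Finset.sum_const,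
      Finset.card_univ, Fintype.card_perm, nsmul_eq_mul, mul_comm, hg, Finset.sum_mul]
    exact (Finset.sum_le_sum hpair).trans_eq Finset.sum_comm
  obtain ⟨σ, _, hσ⟩ := Finset.exists_le_of_sum_le ⟨1, Finset.mem_univ _⟩ havg
  exact ⟨σ, by linarith⟩

/-- A `k`-clique count bound in terms of the number of common neighbours of adjacent pairs. -/
theorem card_cliques_mul_le {G : SimpleGraph V} {d k : ℕ} (hk : 3 ≤ k)
    (hm : ∀ p ∈ adjPairs G, (commonNbrs G p.1 p.2).card ≤ d - 1) :
    cliqueCount G k * (k * (k - 1)) * (k - 2) ≤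
      (d - 2).choose (k - 3) * ∑ p ∈ adjPairs G, (commonNbrs G p.1 p.2).card := by
  set Q := Finset.univ.filter fun t : Finset V => G.IsNClique k t with hQ
  have hcount : cliqueCount G k = Q.card := by
    rw [cliqueCount, Nat.card_eq_fintype_card, Fintype.card_subtype]
  have habove : ∀ t ∈ Q,
      (Finset.bipartiteAbove (fun (t : Finset V) (p : V × V) => p.1 ∈ t ∧ p.2 ∈ t)
        (adjPairs G) t).card = k * (k - 1) := by
    intro t ht
    simp only [hQ, Finset.mem_filter, Finset.mem_univ, true_and] at ht
    have : Finset.bipartiteAbove (fun (t : Finset V) (p : V × V) => p.1 ∈ t ∧ p.2 ∈ t)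
        (adjPairs G) t = t.offDiag := by
      ext ⟨x, y⟩
      simp only [Finset.mem_bipartiteAbove, adjPairs, Finset.mem_filter, Finset.mem_univ,
        true_and, Finset.mem_offDiag]
      exact ⟨fun h => ⟨h.2.1, h.2.2, h.1.ne⟩,
        fun h => ⟨ht.isClique h.1 h.2.1 h.2.2, h.1, h.2.1⟩⟩
    rw [this, Finset.offDiag_card, ht.card_eq, Nat.mul_sub, mul_one]
  have hbelow : ∀ p ∈ adjPairs G,
      (Finset.bipartiteBelow (fun (t : Finset V) (p : V × V) => p.1 ∈ t ∧ p.2 ∈ t) Q p).card *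
        (k - 2) ≤ (d - 2).choose (k - 3) * (commonNbrs G p.1 p.2).card := by
    rintro ⟨x, y⟩ hp
    have hmd := hm _ hp
    simp only [adjPairs, Finset.mem_filter, Finset.mem_univ, true_and] at hp hmd
    have hle : (Finset.bipartiteBelow (fun (t : Finset V) (p : V × V) => p.1 ∈ t ∧ p.2 ∈ t)
        Q (x, y)).card ≤ (commonNbrs G x y).card.choose (k - 2) := by
      rw [← Finset.card_powersetCard]
      refine Finset.card_le_card_of_injOn (fun t => (t.erase x).erase y) ?_ ?_
      · intro t ht
        simp only [Finset.coe_filter, Finset.bipartiteBelow, hQ, Finset.mem_filter,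
          Finset.mem_univ, true_and, Set.mem_ofPred_eq] at ht
        obtain ⟨hcl, hx, hy⟩ := ht
        rw [Finset.mem_coe, Finset.mem_powersetCard]
        refine ⟨fun v hv => ?_, ?_⟩
        · simp only [Finset.mem_erase] at hv
          simp only [commonNbrs, Finset.mem_filter, Finset.mem_univ, true_and]
          exact ⟨hcl.isClique hv.2.2 hx hv.2.1, hcl.isClique hv.2.2 hy hv.1⟩
        · rw [Finset.card_erase_of_mem (by simp [hy, hp.ne']), Finset.card_erase_of_mem hx,
            hcl.card_eq]
          omega
      · intro t ht t' ht' h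
        simp only [Finset.coe_filter, Finset.bipartiteBelow, hQ, Finset.mem_filter,
          Finset.mem_univ, true_and, Set.mem_ofPred_eq] at ht ht'
        ext v
        by_cases hvx : v = x
        · subst hvx
          simp [ht.2.1, ht'.2.1]
        by_cases hvy : v = y
        · subst hvy
          simp [ht.2.2, ht'.2.2]
        have := congrArg (v ∈ ·) h
        simpa [hvx, hvy] using this
    refine (Nat.mul_le_mul_right _ hle).trans ?_
    rcases Nat.eq_zero_or_pos (commonNbrs G x y).card with h0 | hpos
    · rw [h0, Nat.choose_eq_zero_of_lt (by omega)]
      simp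
    · obtain ⟨j, hj⟩ : ∃ j, k - 2 = j + 1 := ⟨k - 3, by omega⟩
      obtain ⟨i, hi⟩ : ∃ i, (commonNbrs G x y).card = i + 1 :=
        ⟨(commonNbrs G x y).card - 1, by omega⟩
      rw [hi, hj, ← Nat.add_one_mul_choose_eq, mul_comm, show k - 3 = j by omega]
      exact Nat.mul_le_mul_right _ (Nat.choose_le_choose _ (by omega))
  rw [hcount, ← smul_eq_mul Q.card, ← Finset.sum_const, ← Finset.sum_congr rfl habove,
    Finset.sum_card_bipartiteAbove_eq_sum_card_bipartiteBelow, Finset.sum_mul, Finset.mul_sum]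
  exact Finset.sum_le_sum hbelow

variable {G : SimpleGraph V} {d : ℕ}

theorem commonNbrs_subset_erase (x y : V) :
    commonNbrs G x y ⊆ (Finset.univ.filter (G.Adj x)).erase y := by
  intro v hv
  simp only [commonNbrs, Finset.mem_erase, Finset.mem_filter, Finset.mem_univ, true_and] at hv ⊢
  exact ⟨hv.2.ne, hv.1.symm⟩

theorem card_commonNbrs_le (hG : ∀ v, (Finset.univ.filter (G.Adj v)).card = d) {x y : V}
    (hxy : G.Adj x y) : (commonNbrs G x y).card ≤ d - 1 := by
  refine (Finset.card_le_card (commonNbrs_subset_erase x y)).trans ?_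
  rw [Finset.card_erase_of_mem (by simpa using hxy), hG]

theorem adj_of_card_commonNbrs (hG : ∀ v, (Finset.univ.filter (G.Adj v)).card = d) {x y z : V}
    (hxy : G.Adj x y) (hcard : d - 1 ≤ (commonNbrs G x y).card) (hxz : G.Adj x z)
    (hzy : z ≠ y) : G.Adj z y := by
  have heq : commonNbrs G x y = (Finset.univ.filter (G.Adj x)).erase y := by
    refine Finset.eq_of_subset_of_card_le (commonNbrs_subset_erase x y) ?_
    rw [Finset.card_erase_of_mem (by simpa using hxy), hG]
    exact hcard
  have hz : z ∈ commonNbrs G x y := by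
    rw [heq]
    simp [hzy, hxz]
  simp only [commonNbrs, Finset.mem_filter, Finset.mem_univ, true_and] at hz
  exact hz.2

theorem card_commonNbrs_pos {x y z : V} (hx : G.Adj z x) (hy : G.Adj z y) :
    0 < (commonNbrs G x y).card :=
  Finset.card_pos.mpr ⟨z, by simp [commonNbrs, hx, hy]⟩

/-- A bad vertex has an edge with some, but not the largest possible number of, common
neighbours. -/
theorem BadVertexK.exists_adj {k : ℕ} (hk : 3 ≤ k)
    (hG : ∀ v, (Finset.univ.filter (G.Adj v)).card = d) {v : V} (hv : BadVertexK G d k v) :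
    ∃ y, G.Adj v y ∧ 0 < (commonNbrs G v y).card ∧ (commonNbrs G v y).card < d - 1 := by
  obtain ⟨⟨t, ht, hvt⟩, hno⟩ := hv
  by_contra! hcon
  have hcard : 1 < (t.erase v).card := by
    rw [Finset.card_erase_of_mem hvt, ht.card_eq]
    omega
  obtain ⟨x, hx, w, hw, hxw⟩ := Finset.one_lt_card.mp hcard
  rw [Finset.mem_erase] at hx hw
  have hvx : G.Adj v x := ht.isClique hvt hx.2 hx.1.symm
  have hvw : G.Adj w v := ht.isClique hw.2 hvt hw.1
  have hwx : G.Adj w x := ht.isClique hw.2 hx.2 hxw.symm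
  have hfullx := hcon x hvx (card_commonNbrs_pos hvw hwx)
  have hpos : ∀ y, G.Adj v y → 0 < (commonNbrs G v y).card := by
    intro y hvy
    by_cases hyx : y = x
    · subst hyx
      exact card_commonNbrs_pos hvw hwx
    · exact card_commonNbrs_pos hvx.symm (adj_of_card_commonNbrs hG hvx hfullx hvy hyx).symm
  refine hno ⟨insert v (Finset.univ.filter (G.Adj v)), ⟨?_, ?_⟩, by simp⟩
  · intro a ha b hb hab
    simp only [Finset.coe_insert, Finset.coe_filter, Finset.mem_univ, true_and,
      Set.mem_insert_iff, Set.mem_ofPred_eq] at ha hb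
    rcases ha with rfl | ha <;> rcases hb with rfl | hb
    · exact absurd rfl hab
    · exact hb
    · exact ha.symm
    · exact adj_of_card_commonNbrs hG hb (hcon b hb (hpos b hb)) ha hab
  · rw [Finset.card_insert_of_notMem (by simp), hG]

/-- The expected saving exceeds the one predicted by the number of triangles by a constant
for each bad vertex. -/
theorem sum_commonNbrs_add_bad_le {k : ℕ} (hk : 3 ≤ k)
    (hG : ∀ v, (Finset.univ.filter (G.Adj v)).card = d) :
    (∑ p ∈ adjPairs G, ((commonNbrs G p.1 p.2).card : ℝ)) / (d + 1) +
        badVertexCountK G d k / (d * (d + 1)) ≤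
      ∑ p ∈ adjPairs G,
        ((commonNbrs G p.1 p.2).card : ℝ) / ((commonNbrs G p.1 p.2).card + 2) := by
  set P := (adjPairs G).filter fun p =>
    0 < (commonNbrs G p.1 p.2).card ∧ (commonNbrs G p.1 p.2).card < d - 1 with hP
  have hbad : badVertexCountK G d k ≤ P.card := by
    rw [badVertexCountK, Nat.card_eq_fintype_card, Fintype.card_subtype]
    refine (Finset.card_le_card (t := P.image Prod.fst) fun v hv => ?_).trans
      Finset.card_image_le
    simp only [Finset.mem_filter, Finset.mem_univ, true_and] at hv
    obtain ⟨y, hy, h⟩ := hv.exists_adj hk hG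
    refine Finset.mem_image.mpr ⟨(v, y), ?_, rfl⟩
    simp only [hP, adjPairs, Finset.mem_filter, Finset.mem_univ, true_and]
    exact ⟨hy, h⟩
  have hpt : ∀ p ∈ adjPairs G, ((commonNbrs G p.1 p.2).card : ℝ) / (d + 1) +
      (if 0 < (commonNbrs G p.1 p.2).card ∧ (commonNbrs G p.1 p.2).card < d - 1
        then 1 / ((d : ℝ) * (d + 1)) else 0) ≤
      ((commonNbrs G p.1 p.2).card : ℝ) / ((commonNbrs G p.1 p.2).card + 2) := by
    rintro ⟨x, y⟩ hp
    simp only [adjPairs, Finset.mem_filter, Finset.mem_univ, true_and] at hp ⊢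
    have hle := card_commonNbrs_le hG hp
    have hd : 0 < d := by
      rw [← hG x]
      exact Finset.card_pos.mpr ⟨y, by simpa using hp⟩
    generalize (commonNbrs G x y).card = m at hle
    split_ifs with h
    · have h1 : (1 : ℝ) ≤ m := by exact_mod_cast h.1
      have h2 : (m : ℝ) + 2 ≤ d := by exact_mod_cast (by omega : m + 2 ≤ d)
      have hd' : (0 : ℝ) < d := by exact_mod_cast hd
      rw [div_add_div _ _ (by positivity) (by positivity), div_le_div_iff₀ (by positivity)
        (by positivity)]
      have h3 : 0 ≤ (m : ℝ) * (d - 1 - m) * d - (m + 2) := by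
        have : (d : ℝ) ≤ m * (d - 1 - m) * d := by
          have : (1 : ℝ) ≤ m * (d - 1 - m) := by nlinarith
          nlinarith
        linarith
      nlinarith [mul_nonneg h3 (by positivity : (0 : ℝ) ≤ (d : ℝ) + 1)]
    · rw [add_zero]
      have h2 : (m : ℝ) + 2 ≤ d + 1 := by exact_mod_cast (by omega : m + 2 ≤ d + 1)
      exact div_le_div_of_nonneg_left (by positivity) (by positivity) h2
  refine le_trans ?_ (Finset.sum_le_sum hpt)
  rw [Finset.sum_add_distrib, ← Finset.sum_div, ← Finset.sum_filter, Finset.sum_const,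
    nsmul_eq_mul, mul_one_div]
  gcongr

end Counting

section UpperBound

theorem choose_mul_mul_eq {d k : ℕ} (hk : 3 ≤ k) (hd : k - 1 ≤ d) :
    d.choose (k - 1) * ((k - 1) * (k - 2)) = d * (d - 1) * (d - 2).choose (k - 3) := by
  obtain ⟨j, rfl⟩ : ∃ j, k = j + 3 := ⟨k - 3, by omega⟩
  obtain ⟨i, rfl⟩ : ∃ i, d = i + 2 := ⟨d - 2, by omega⟩
  have h1 := Nat.add_one_mul_choose_eq (i + 1) (j + 1)
  have h2 := Nat.add_one_mul_choose_eq i j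
  simp only [show j + 3 - 1 = j + 2 by omega, show j + 3 - 2 = j + 1 by omega,
    show i + 2 - 1 = i + 1 by omega, show i + 2 - 2 = i by omega, show j + 3 - 3 = j by omega]
  calc (i + 2).choose (j + 2) * ((j + 2) * (j + 1))
      = (i + 1 + 1).choose (j + 1 + 1) * (j + 1 + 1) * (j + 1) := by ring
    _ = (i + 2) * ((i + 1).choose (j + 1) * (j + 1)) := by rw [← h1]; ring
    _ = _ := by rw [← h2]; ring

open scoped Classical in
theorem IsDRegular.card_filter_adj {V : Type*} [Fintype V] {G : SimpleGraph V} {d : ℕ}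
    (hG : IsDRegular G d) (v : V) : (Finset.univ.filter (G.Adj v)).card = d := by
  rw [← hG v, Set.ncard_eq_toFinset_card']
  congr 1
  ext w
  simp

/-- The exponent of `n` in the number of graphs with many bad vertices. -/
noncomputable def unsavedEdgeBound (n d : ℕ) (c ε : ℝ) : ℝ :=
  (n * d - c * n * (d * (d - 1)) / (d + 1) - ε * n / (d * (d + 1))) / 2

open scoped Classical in
theorem exists_unsaved_of_bad {n k d : ℕ} (hk : 3 ≤ k) (hd : k - 1 ≤ d) {c ε : ℝ}
    {G : SimpleGraph (Fin n)} (hG : G ∈ Gdck n d c k)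
    (hbad : ε * n < (badVertexCountK G d k : ℝ)) :
    ∃ F : SimpleGraph (Fin n), TriangleGenerates F G ∧
      ((adjPairs F).card : ℝ) ≤ 2 * unsavedEdgeBound n d c ε := by
  obtain ⟨hreg, hcl⟩ := hG
  have hdeg := hreg.card_filter_adj
  have hmd : ∀ p ∈ adjPairs G, (commonNbrs G p.1 p.2).card ≤ d - 1 := fun p hp =>
    card_commonNbrs_le hdeg (by simpa [adjPairs] using hp)
  set M := ∑ p ∈ adjPairs G, (commonNbrs G p.1 p.2).card with hM
  have hup := card_cliques_mul_le hk hmd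
  have hpairs : (adjPairs G).card = n * d := by
    rw [card_adjPairs_eq_sum, Finset.sum_congr rfl fun v _ => hdeg v]
    simp
  have hMlow : c * n * (d * (d - 1)) ≤ M := by
    have hchoose := choose_mul_mul_eq hk hd
    obtain ⟨j, rfl⟩ : ∃ j, k = j + 3 := ⟨k - 3, by omega⟩
    obtain ⟨i, rfl⟩ : ∃ i, d = i + 2 := ⟨d - 2, by omega⟩
    simp only [show j + 3 - 1 = j + 2 by omega, show j + 3 - 2 = j + 1 by omega,
      show i + 2 - 1 = i + 1 by omega, show i + 2 - 2 = i by omega,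
      show j + 3 - 3 = j by omega] at hchoose hup hcl
    rw [← hM] at hup
    have hup' : (cliqueCount G (j + 3) : ℝ) * ((j + 3) * (j + 2)) * (j + 1) ≤
        i.choose j * M := by exact_mod_cast hup
    have hchoose' : ((i + 2).choose (j + 2) : ℝ) * ((j + 2) * (j + 1)) =
        (i + 2) * (i + 1) * i.choose j := by exact_mod_cast hchoose
    have hpos : (0 : ℝ) < i.choose j := by
      exact_mod_cast Nat.choose_pos (by omega)
    rw [mul_div_assoc', div_le_iff₀ (by positivity)] at hcl
    push_cast at hcl ⊢
    refine le_of_mul_le_mul_left ?_ hpos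
    calc (i.choose j : ℝ) * (c * n * ((i + 2) * (i + 2 - 1)))
        = c * n * ((i + 2) * (i + 1) * i.choose j) := by ring
      _ = c * ((i + 2).choose (j + 2) * n) * ((j + 2) * (j + 1)) := by
          rw [← hchoose']; ring
      _ ≤ cliqueCount G (j + 3) * (j + 3) * ((j + 2) * (j + 1)) := by gcongr
      _ = cliqueCount G (j + 3) * ((j + 3) * (j + 2)) * (j + 1) := by ring
      _ ≤ _ := hup'
  obtain ⟨σ, hσ⟩ := exists_card_unsaved_le G
  refine ⟨unsavedGraph G σ, unsavedGraph_generates G σ, ?_⟩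
  have hgain := sum_commonNbrs_add_bad_le hk hdeg
  have h1 : c * n * (d * (d - 1)) / (d + 1) ≤
      (∑ p ∈ adjPairs G, ((commonNbrs G p.1 p.2).card : ℝ)) / (d + 1) := by
    rw [hM] at hMlow
    push_cast at hMlow
    gcongr
  have h2 : ε * n / (d * (d + 1)) ≤ badVertexCountK G d k / ((d : ℝ) * (d + 1)) := by
    gcongr
  rw [hpairs] at hσ
  push_cast at hσ
  rw [unsavedEdgeBound]
  linarith

open scoped Classical in
/-- A bound on the number of regular graphs generated by graphs with at most `f` edges. -/
theorem card_generated_by_few_edges_le {V : Type*} [Fintype V] (hV : 0 < Fintype.card V) {d : ℕ}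
    {f : ℝ} {S : Set (SimpleGraph V)}
    (hS : ∀ G ∈ S, IsDRegular G d ∧
      ∃ F, TriangleGenerates F G ∧ ((adjPairs F).card : ℝ) ≤ 2 * f) :
    (Nat.card S : ℝ) ≤ Real.exp (Fintype.card V) * (Fintype.card V : ℝ) ^ f *
      2 ^ (Fintype.card V * d ^ 2) := by
  set 𝓕 := Finset.univ.filter fun F : SimpleGraph V => ((adjPairs F).card : ℝ) ≤ 2 * f with hF
  have hcard : Nat.card S ≤ 𝓕.card * 2 ^ (Fintype.card V * d ^ 2) := by
    rw [Nat.card_coe_set_eq, Set.ncard_eq_toFinset_card']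
    refine (Finset.card_le_card fun G hG => ?_).trans (Finset.card_biUnion_le_card_mul 𝓕
      (fun F => Finset.univ.filter fun G : SimpleGraph V =>
        TriangleGenerates F G ∧ (wedges G).card ≤ Fintype.card V * d ^ 2) _
      fun F _ => card_generated_le _ F)
    obtain ⟨hreg, F, hgen, hFc⟩ := hS G (Set.mem_toFinset.mp hG)
    simp only [Finset.mem_biUnion, hF, Finset.mem_filter, Finset.mem_univ, true_and]
    exact ⟨F, hFc, hgen, (card_wedges hreg.card_filter_adj).le⟩
  calc (Nat.card S : ℝ) ≤ ((𝓕.card * 2 ^ (Fintype.card V * d ^ 2) : ℕ) : ℝ) := by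
        exact_mod_cast hcard
    _ = (𝓕.card : ℝ) * 2 ^ (Fintype.card V * d ^ 2) := by push_cast; ring
    _ ≤ _ := by
        gcongr
        exact card_graphs_le f hV

theorem card_many_bad_le {n k d : ℕ} (hk : 3 ≤ k) (hd : k - 1 ≤ d) (hn : 0 < n) (c ε : ℝ) :
    (Nat.card {G : SimpleGraph (Fin n) | G ∈ Gdck n d c k ∧
      ε * n < (badVertexCountK G d k : ℝ)} : ℝ) ≤
    Real.exp n * (n : ℝ) ^ unsavedEdgeBound n d c ε * 2 ^ (n * d ^ 2) := by
  have h := card_generated_by_few_edges_le (V := Fin n) (by simpa using hn) (d := d)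
    (f := unsavedEdgeBound n d c ε)
    (S := {G : SimpleGraph (Fin n) | G ∈ Gdck n d c k ∧ ε * n < (badVertexCountK G d k : ℝ)})
    fun G hG => ⟨hG.1.1, exists_unsaved_of_bad hk hd hG.1 hG.2⟩
  rwa [Fintype.card_fin] at h

end UpperBound

section Construction

variable {d m q : ℕ}

/-- The permutation of the fibre over `b`, the identity over `none`. -/
def fibrePerm (σ : Fin d → Equiv.Perm (Fin m)) (b : Option (Fin d)) : Equiv.Perm (Fin m) :=
  b.elim 1 σ

/-- A disjoint union of `m` cliques on `d + 1` vertices, each a transversal of `d + 1` fixed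
blocks. -/
def transversalCliques (σ : Fin d → Equiv.Perm (Fin m)) :
    SimpleGraph (Option (Fin d) × Fin m) where
  Adj p r := p.1 ≠ r.1 ∧ fibrePerm σ p.1 p.2 = fibrePerm σ r.1 r.2
  symm := ⟨fun _ _ h => ⟨h.1.symm, h.2.symm⟩⟩
  loopless := ⟨fun _ h => h.1 rfl⟩

theorem transversalCliques_isDRegular (σ : Fin d → Equiv.Perm (Fin m)) :
    IsDRegular (transversalCliques σ) d := by
  rintro ⟨a, i⟩
  have hrange : (transversalCliques σ).neighborSet (a, i) =
      Set.range fun b : {b // b ≠ a} =>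
        ((b : Option (Fin d)), (fibrePerm σ b).symm (fibrePerm σ a i)) := by
    ext ⟨b, j⟩
    simp only [SimpleGraph.mem_neighborSet, transversalCliques, Set.mem_range, Prod.mk.injEq,
      Subtype.exists]
    constructor
    · rintro ⟨h1, h2⟩
      exact ⟨b, h1.symm, rfl, by rw [h2, Equiv.symm_apply_apply]⟩
    · rintro ⟨b', h1, rfl, h2⟩
      exact ⟨h1.symm, by rw [← h2, Equiv.apply_symm_apply]⟩
  rw [hrange, Set.ncard_range_of_injective]
  · simp
  · intro b b' h
    exact Subtype.ext (congrArg Prod.fst h)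

theorem transversalCliques_injective :
    Function.Injective (transversalCliques : (Fin d → Equiv.Perm (Fin m)) → _) := by
  intro σ σ' h
  funext a
  ext i : 1
  have hadj : (transversalCliques σ).Adj (none, σ a i) (some a, i) :=
    ⟨by simp, by simp [fibrePerm]⟩
  rw [h] at hadj
  simpa [fibrePerm] using hadj.2

/-- The vertex over `b` of the clique with index `j`. -/
def cliquePoint (σ : Fin d → Equiv.Perm (Fin m)) (j : Fin m) :
    Option (Fin d) ↪ Option (Fin d) × Fin m where
  toFun b := (b, (fibrePerm σ b).symm j)
  inj' _ _ h := congrArg Prod.fst h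

theorem cliquePoint_apply (σ : Fin d → Equiv.Perm (Fin m)) (j : Fin m) (b : Option (Fin d)) :
    cliquePoint σ j b = (b, (fibrePerm σ b).symm j) := rfl

theorem le_cliqueCount_transversalCliques (σ : Fin d → Equiv.Perm (Fin m)) {k : ℕ}
    (hk : 0 < k) : m * (d + 1).choose k ≤ cliqueCount (transversalCliques σ) k := by
  classical
  have hcard : m * (d + 1).choose k =
      Nat.card (Fin m × {s : Finset (Option (Fin d)) // s.card = k}) := by
    simp
  rw [hcard, cliqueCount]
  refine Nat.card_le_card_of_injective
    (fun p => ⟨p.2.1.map (cliquePoint σ p.1), ⟨?_, by rw [Finset.card_map, p.2.2]⟩⟩) ?_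
  · intro x hx y hy hxy
    simp only [Finset.coe_map, Set.mem_image, Finset.mem_coe] at hx hy
    obtain ⟨b, -, rfl⟩ := hx
    obtain ⟨b', -, rfl⟩ := hy
    refine ⟨fun h => hxy (congrArg _ ?_), by simp [cliquePoint_apply]⟩
    simpa only [cliquePoint_apply] using h
  · rintro ⟨j, s, hs⟩ ⟨j', s', hs'⟩ h
    have hmap : s.map (cliquePoint σ j) = s'.map (cliquePoint σ j') := congrArg Subtype.val h
    obtain ⟨b, hb⟩ : s.Nonempty := Finset.card_pos.mp (hs ▸ hk)
    have hss : s = s' := by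
      have := congrArg (Finset.image Prod.fst) hmap
      simpa [Finset.map_eq_image, Finset.image_image, cliquePoint_apply,
        Function.comp_def] using this
    have hj : j = j' := by
      have hmem : cliquePoint σ j b ∈ s'.map (cliquePoint σ j') :=
        hmap ▸ Finset.mem_map_of_mem _ hb
      obtain ⟨b', -, hb'⟩ := Finset.mem_map.mp hmem
      simp only [cliquePoint_apply, Prod.mk.injEq] at hb'
      obtain ⟨rfl, h2⟩ := hb'
      exact ((fibrePerm σ b').symm.injective h2).symm
    subst hss hj
    rfl

/-- The bipartite graph with `d` blocks of size `q` on each side and a perfect matching between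
any two blocks on different sides. -/
def blockMatchings (τ : Fin d → Fin d → Equiv.Perm (Fin q)) :
    SimpleGraph ((Fin d × Fin q) ⊕ (Fin d × Fin q)) where
  Adj
    | Sum.inl x, Sum.inr y => τ x.1 y.1 x.2 = y.2
    | Sum.inr y, Sum.inl x => τ x.1 y.1 x.2 = y.2
    | _, _ => False
  symm := ⟨by rintro (x | x) (y | y) h <;> exact h⟩
  loopless := ⟨by rintro (x | x) h <;> exact h⟩

theorem blockMatchings_isDRegular (τ : Fin d → Fin d → Equiv.Perm (Fin q)) :
    IsDRegular (blockMatchings τ) d := by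
  rintro (⟨i, x⟩ | ⟨j, y⟩)
  · have hrange : (blockMatchings τ).neighborSet (Sum.inl (i, x)) =
        Set.range fun j : Fin d => Sum.inr (j, τ i j x) := by
      ext (z | ⟨j, y⟩)
      · simp [blockMatchings]
      · simp [blockMatchings]
    rw [hrange, Set.ncard_range_of_injective]
    · simp
    · intro j j' h
      simpa using congrArg (Sum.elim Prod.fst Prod.fst) h
  · have hrange : (blockMatchings τ).neighborSet (Sum.inr (j, y)) =
        Set.range fun i : Fin d => Sum.inl (i, (τ i j).symm y) := by
      ext (⟨i, x⟩ | z)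
      · simp only [SimpleGraph.mem_neighborSet, blockMatchings, Set.mem_range, Sum.inl.injEq,
          Prod.mk.injEq, exists_eq_left, Equiv.symm_apply_eq]
        exact eq_comm
      · simp [blockMatchings]
    rw [hrange, Set.ncard_range_of_injective]
    · simp
    · intro i i' h
      simpa using congrArg (Sum.elim Prod.fst Prod.fst) h

theorem blockMatchings_injective :
    Function.Injective (blockMatchings : (Fin d → Fin d → Equiv.Perm (Fin q)) → _) := by
  intro τ τ' h
  funext i j
  ext x : 1
  have hadj : (blockMatchings τ).Adj (Sum.inl (i, x)) (Sum.inr (j, τ i j x)) := rfl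
  rw [h] at hadj
  exact (show τ' i j x = τ i j x from hadj).symm

theorem IsDRegular.sum {V W : Type*} {G : SimpleGraph V} {H : SimpleGraph W}
    (hG : IsDRegular G d) (hH : IsDRegular H d) : IsDRegular (G ⊕g H) d := by
  rintro (v | w)
  · have : (G ⊕g H).neighborSet (Sum.inl v) = Sum.inl '' G.neighborSet v := by
      ext (x | x) <;> simp
    rw [this, Set.ncard_image_of_injective _ Sum.inl_injective, hG v]
  · have : (G ⊕g H).neighborSet (Sum.inr w) = Sum.inr '' H.neighborSet w := by
      ext (x | x) <;> simp
    rw [this, Set.ncard_image_of_injective _ Sum.inr_injective, hH w]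

theorem IsDRegular.iso {V W : Type*} {G : SimpleGraph V} {H : SimpleGraph W} (e : G ≃g H)
    (hH : IsDRegular H d) : IsDRegular G d := fun v =>
  (Set.ncard_congr' (e.mapNeighborSet v)).trans (hH (e v))

theorem cliqueCount_le_of_embedding {V W : Type*} [Finite W] {G : SimpleGraph V}
    {H : SimpleGraph W} (e : G ↪g H) (k : ℕ) : cliqueCount G k ≤ cliqueCount H k := by
  refine Nat.card_le_card_of_injective
    (fun t => ⟨t.1.map e.toEmbedding, ⟨?_, by rw [Finset.card_map, t.2.card_eq]⟩⟩) ?_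
  · intro x hx y hy hxy
    simp only [Finset.coe_map, Set.mem_image, Finset.mem_coe] at hx hy
    obtain ⟨a, ha, rfl⟩ := hx
    obtain ⟨b, hb, rfl⟩ := hy
    exact e.map_rel_iff.mpr (t.2.isClique ha hb fun h => hxy (by rw [h]))
  · intro t t' h
    exact Subtype.ext (Finset.map_injective _ (congrArg Subtype.val h))

theorem le_card_Gdck {n k : ℕ} {c : ℝ} (hk : 0 < k) (hn : (d + 1) * m + 2 * d * q = n)
    (hm : c * n / (d + 1) ≤ m) :
    m.factorial ^ d * q.factorial ^ (d * d) ≤ Nat.card (Gdck n d c k) := by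
  have hV : Fintype.card ((Option (Fin d) × Fin m) ⊕ ((Fin d × Fin q) ⊕ (Fin d × Fin q))) = n := by
    simp only [Fintype.card_sum, Fintype.card_prod, Fintype.card_option, Fintype.card_fin]
    rw [← hn]
    ring
  let e := (Fintype.equivFinOfCardEq hV).symm
  have hmem : ∀ p : (Fin d → Equiv.Perm (Fin m)) × (Fin d → Fin d → Equiv.Perm (Fin q)),
      (transversalCliques p.1 ⊕g blockMatchings p.2).comap e ∈ Gdck n d c k := by
    intro p
    refine ⟨((transversalCliques_isDRegular p.1).sum (blockMatchings_isDRegular p.2)).iso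
      (SimpleGraph.Iso.comap e _), ?_⟩
    have h1 := (le_cliqueCount_transversalCliques p.1 hk).trans (cliqueCount_le_of_embedding
      ((SimpleGraph.Iso.comap e _).symm.toEmbedding.comp
        (SimpleGraph.Embedding.sumInl (H := blockMatchings p.2))) k)
    obtain ⟨j, rfl⟩ : ∃ j, k = j + 1 := ⟨k - 1, by omega⟩
    have h2 : ((d + 1 : ℕ) : ℝ) * d.choose j = (d + 1).choose (j + 1) * (j + 1 : ℕ) := by
      exact_mod_cast Nat.add_one_mul_choose_eq d j
    refine le_trans ?_ (Nat.cast_le.mpr h1)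
    rw [div_le_iff₀ (by positivity)] at hm
    rw [mul_div_assoc', div_le_iff₀ (by positivity), Nat.add_sub_cancel]
    push_cast at h2 ⊢
    calc c * (d.choose j * n) = d.choose j * (c * n) := by ring
      _ ≤ d.choose j * (m * (d + 1)) := by gcongr
      _ = m * ((d + 1) * d.choose j) := by ring
      _ = _ := by rw [h2]; ring
  have hcard : m.factorial ^ d * q.factorial ^ (d * d) =
      Nat.card ((Fin d → Equiv.Perm (Fin m)) × (Fin d → Fin d → Equiv.Perm (Fin q))) := by
    simp [Fintype.card_perm, pow_mul]
  rw [hcard]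
  refine Nat.card_le_card_of_injective (fun p => ⟨_, hmem p⟩) fun p p' h => ?_
  have hG : transversalCliques p.1 ⊕g blockMatchings p.2 =
      transversalCliques p'.1 ⊕g blockMatchings p'.2 := by
    ext x y
    have hadj := congrArg (fun H => H.Adj (e.symm x) (e.symm y)) (congrArg Subtype.val h)
    simpa only [SimpleGraph.comap_adj, Equiv.apply_symm_apply, eq_iff_iff] using hadj
  refine Prod.ext (transversalCliques_injective ?_) (blockMatchings_injective ?_)
  · ext x y
    rw [← SimpleGraph.sum_adj_inl (H := blockMatchings p.2), hG, SimpleGraph.sum_adj_inl]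
  · ext x y
    rw [← SimpleGraph.sum_adj_inr (G := transversalCliques p.1), hG, SimpleGraph.sum_adj_inr]

end Construction

section Asymptotics

theorem exists_block_sizes {n d : ℕ} {c : ℝ} (hc0 : 0 < c) (hd : 0 < d) (heven : Even (n * d))
    (hn : c * n + 2 * d * (d + 1) ≤ n) :
    ∃ m q : ℕ, (d + 1) * m + 2 * d * q = n ∧ c * n / (d + 1) ≤ m ∧
      (m : ℝ) ≤ c * n / (d + 1) + 2 * d := by
  set m₀ := ⌈c * n / (d + 1)⌉₊ with hm₀
  have hlow : c * n / (d + 1) ≤ m₀ := Nat.le_ceil _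
  have hupp : (m₀ : ℝ) < c * n / (d + 1) + 1 := Nat.ceil_lt_add_one (by positivity)
  set t : ℤ := n - (d + 1) * m₀ with ht
  set r : ℤ := ((d + 1) * t) % (2 * d) with hr
  have hr0 : 0 ≤ r := Int.emod_nonneg _ (by omega)
  have hrlt : r < 2 * d := Int.emod_lt_of_pos _ (by omega)
  have hdt : Even ((d : ℤ) * t) := by
    have h1 : Even ((n : ℤ) * d) := by exact_mod_cast heven
    have h2 : Even ((d : ℤ) * (d + 1)) := Int.even_mul_succ_self d
    have h3 : (d : ℤ) * t = n * d - d * (d + 1) * m₀ := by rw [ht]; ring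
    rw [h3]
    exact h1.sub (h2.mul_right _)
  obtain ⟨u, hu⟩ := hdt
  obtain ⟨s, hs⟩ : ∃ s, (d + 1) * t = r + 2 * d * s :=
    ⟨_, (Int.emod_add_mul_ediv ((d + 1) * t) (2 * d)).symm⟩
  obtain ⟨r', hr'⟩ := Int.eq_ofNat_of_zero_le hr0
  have hr'le : (r' : ℝ) ≤ 2 * d - 1 := by
    have : (r' : ℤ) + 1 ≤ 2 * d := by omega
    have : (r' : ℝ) + 1 ≤ 2 * d := by exact_mod_cast this
    linarith
  have hm : ((m₀ + r' : ℕ) : ℝ) ≤ c * n / (d + 1) + 2 * d := by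
    push_cast
    linarith
  have hle : ((d : ℤ) + 1) * (m₀ + r') ≤ n := by
    have h1 : ((d : ℝ) + 1) * (m₀ + r' : ℕ) ≤ (d + 1) * (c * n / (d + 1) + 2 * d) := by gcongr
    have h2 : ((d : ℝ) + 1) * (c * n / (d + 1) + 2 * d) = c * n + 2 * d * (d + 1) := by
      field_simp
    exact_mod_cast h1.trans (h2.le.trans hn)
  set w : ℤ := (d + 1) * s - u - t with hw
  have heq : (n : ℤ) - (d + 1) * (m₀ + r') = 2 * d * w := by
    have h1 : (r' : ℤ) = (d + 1) * t - 2 * d * s := by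
      rw [hs, hr']
      simp
    rw [h1, hw]
    linear_combination -ht - d * hu
  have hw0 : 0 ≤ w := by
    by_contra hneg
    have : 2 * (d : ℤ) * w < 0 := mul_neg_of_pos_of_neg (by omega) (by omega)
    linarith
  obtain ⟨q, hq⟩ := Int.eq_ofNat_of_zero_le hw0
  refine ⟨m₀ + r', q, ?_, ?_, hm⟩
  · rw [hq] at heq
    zify
    linarith
  · push_cast
    linarith [(Nat.cast_nonneg r' : (0 : ℝ) ≤ r')]

theorem exp_le_factorial {n : ℕ} (hn : 0 < n) (m : ℕ) :
    Real.exp (m * Real.log n - n) ≤ m.factorial := by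
  have hn' : (0 : ℝ) < n := by exact_mod_cast hn
  have h := Real.pow_div_factorial_le_exp n hn'.le m
  rw [div_le_iff₀ (by positivity)] at h
  rw [Real.exp_sub, Real.exp_nat_mul, Real.exp_log hn', div_le_iff₀ (Real.exp_pos _), mul_comm]
  exact h

theorem exp_le_card_Gdck {n k d : ℕ} {c : ℝ} (hk : 0 < k) (hd : 0 < d) (hc0 : 0 < c)
    (heven : Even (n * d)) (hn0 : 0 < n) (hn : c * n + 2 * d * (d + 1) ≤ n) :
    Real.exp ((n * d / 2 - c * n * (d * (d - 1)) / (d + 1) / 2 - d ^ 2 * (d - 1)) * Real.log n -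
      n * (d + d ^ 2)) ≤ Nat.card (Gdck n d c k) := by
  obtain ⟨m, q, hmq, hmlow, hmupp⟩ := exists_block_sizes hc0 hd heven hn
  have hcard : (m.factorial : ℝ) ^ d * (q.factorial : ℝ) ^ (d * d) ≤
      Nat.card (Gdck n d c k) := by
    exact_mod_cast le_card_Gdck hk hmq hmlow
  have hlog : 0 ≤ Real.log n := Real.log_natCast_nonneg n
  have hd1 : (1 : ℝ) ≤ d := by exact_mod_cast hd
  have hexp : (n * d / 2 - c * n * (d * (d - 1)) / (d + 1) / 2 - d ^ 2 * (d - 1) : ℝ) ≤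
      d * m + d * d * q := by
    have hmq' : ((d : ℝ) + 1) * m + 2 * d * q = n := by exact_mod_cast hmq
    have h1 : (d : ℝ) * (d - 1) * m ≤ d * (d - 1) * (c * n / (d + 1) + 2 * d) :=
      mul_le_mul_of_nonneg_left hmupp (mul_nonneg (by linarith) (by linarith))
    have h2 : (d : ℝ) * (d - 1) * (c * n / (d + 1) + 2 * d) =
        c * n * (d * (d - 1)) / (d + 1) + 2 * (d ^ 2 * (d - 1)) := by ring
    have h3 : 2 * ((d : ℝ) * m + d * d * q) = n * d - d * (d - 1) * m := by
      rw [← hmq']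
      ring
    linarith
  calc _ ≤ Real.exp ((d * m + d * d * q) * Real.log n - n * (d + d ^ 2)) := by gcongr
    _ = Real.exp (m * Real.log n - n) ^ d * Real.exp (q * Real.log n - n) ^ (d * d) := by
        rw [← Real.exp_nat_mul, ← Real.exp_nat_mul, ← Real.exp_add]
        push_cast
        ring_nf
    _ ≤ (m.factorial : ℝ) ^ d * (q.factorial : ℝ) ^ (d * d) := by
        gcongr <;> exact exp_le_factorial hn0 _
    _ ≤ _ := hcard

theorem ratio_le_exp {n k d : ℕ} {c ε : ℝ} (hk : 3 ≤ k) (hd : k - 1 ≤ d) (hc0 : 0 < c)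
    (heven : Even (n * d)) (hn0 : 0 < n) (hn : c * n + 2 * d * (d + 1) ≤ n) :
    (Nat.card {G : SimpleGraph (Fin n) | G ∈ Gdck n d c k ∧
      ε * n < (badVertexCountK G d k : ℝ)} : ℝ) / (Nat.card (Gdck n d c k) : ℝ) ≤
    Real.exp ((d ^ 2 * (d - 1) - ε / (2 * (d * (d + 1))) * n) * Real.log n +
      n * (1 + d + 2 * d ^ 2)) := by
  have hlow := exp_le_card_Gdck (k := k) (by omega) (by omega) hc0 heven hn0 hn
  have hupp := card_many_bad_le hk hd hn0 c ε
  have hn' : (0 : ℝ) < n := by exact_mod_cast hn0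
  have htwo : (2 : ℝ) ^ (n * d ^ 2) ≤ Real.exp (n * d ^ 2) := by
    have h := pow_le_pow_left₀ zero_le_two
      (by linarith [Real.add_one_le_exp 1] : (2 : ℝ) ≤ Real.exp 1) (n * d ^ 2)
    rwa [← Real.exp_nat_mul, mul_one, Nat.cast_mul, Nat.cast_pow] at h
  rw [div_le_iff₀ ((Real.exp_pos _).trans_le hlow)]
  calc _ ≤ Real.exp n * (n : ℝ) ^ unsavedEdgeBound n d c ε * Real.exp (n * d ^ 2) :=
        hupp.trans (by gcongr)
    _ = Real.exp ((d ^ 2 * (d - 1) - ε / (2 * (d * (d + 1))) * n) * Real.log n +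
          n * (1 + d + 2 * d ^ 2)) *
        Real.exp ((n * d / 2 - c * n * (d * (d - 1)) / (d + 1) / 2 - d ^ 2 * (d - 1)) *
          Real.log n - n * (d + d ^ 2)) := by
        have hd0 : (d : ℝ) ≠ 0 := by
          exact_mod_cast (by omega : d ≠ 0)
        rw [Real.rpow_def_of_pos hn', ← Real.exp_add, ← Real.exp_add, ← Real.exp_add,
          unsavedEdgeBound]
        congr 1
        field_simp
        ring
    _ ≤ _ := by gcongr

end Asymptotics

/-- Structure theorem for `k`-cliques, fixed `d`: the proportion of graphs in
`G_{d,c,k}(n)` with more than `ε n` bad vertices tends to `0` as `n → ∞` along `n` with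
`n*d` even. -/
theorem k_clique_structure (k d : ℕ) (hk : 3 ≤ k) (hd : k - 1 ≤ d) (c : ℝ)
    (hc0 : 0 < c) (hc1 : c < 1) (ε : ℝ) (hε : 0 < ε) :
    Tendsto
      (fun n : ℕ =>
        (Nat.card {G : SimpleGraph (Fin n) | G ∈ Gdck n d c k ∧
            ε * n < (badVertexCountK G d k : ℝ)} : ℝ) /
          (Nat.card (Gdck n d c k) : ℝ))
      (atTop ⊓ 𝓟 {n : ℕ | Even (n * d)}) (nhds 0) := by
  have hd0 : (0 : ℝ) < d := by exact_mod_cast (by omega : 0 < d)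
  set a : ℝ := ε / (2 * (d * (d + 1))) with ha
  have ha0 : 0 < a := by positivity
  have hcast : Tendsto (fun n : ℕ => (n : ℝ)) atTop atTop := tendsto_natCast_atTop_atTop
  have hbound : ∀ᶠ n : ℕ in atTop ⊓ 𝓟 {n : ℕ | Even (n * d)},
      (Nat.card {G : SimpleGraph (Fin n) | G ∈ Gdck n d c k ∧
        ε * n < (badVertexCountK G d k : ℝ)} : ℝ) / (Nat.card (Gdck n d c k) : ℝ) ≤
      Real.exp (-n) := by
    rw [eventually_inf_principal]
    filter_upwards [eventually_gt_atTop 0,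
      hcast.eventually_ge_atTop (2 * d * (d + 1) / (1 - c)),
      hcast.eventually_ge_atTop (2 * (d ^ 2 * (d - 1)) / a),
      (Real.tendsto_log_atTop.comp hcast).eventually_ge_atTop
        (2 * (2 + d + 2 * d ^ 2) / a)] with n hn0 hn1 hn2 hlog heven
    rw [div_le_iff₀ (by linarith)] at hn1
    rw [div_le_iff₀ ha0] at hn2 hlog
    rw [Function.comp_apply] at hlog
    refine (ratio_le_exp hk hd hc0 heven hn0 (by linarith)).trans (Real.exp_le_exp.mpr ?_)
    rw [← ha]
    have hlog0 : 0 ≤ Real.log n := Real.log_natCast_nonneg n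
    have hn' : (0 : ℝ) ≤ n := Nat.cast_nonneg n
    have h1 : (d ^ 2 * (d - 1) - a * n : ℝ) * Real.log n ≤ -(a * n / 2) * Real.log n :=
      mul_le_mul_of_nonneg_right (by linarith) hlog0
    have h2 := mul_le_mul_of_nonneg_left hlog hn'
    linarith
  refine squeeze_zero' (Eventually.of_forall fun n => by positivity) hbound ?_
  exact (Real.tendsto_exp_neg_atTop_nhds_zero.comp hcast).mono_left inf_le_left
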